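/- arXiv:2410.16036 — 2 statements merged into one kernel-verified Lean document; each statement's English description precedes it below -/
import Mathlib

section
/- Let n ∈ ℕ and let v : ℝ → ℝ be Lebesgue integrable. Suppose that for every p ∈ ℝ one has ∫_ℝ v(x − p) · (H_n(x))² · e^{−x²} dx = 0, where H_n is the probabilists' Hermite polynomial. Then v(x) = 0 for almost every x ∈ ℝ. -/
open MeasureTheory Polynomial

section Fourier

open scoped FourierTransform ContDiff

/-- An integrable function whose Fourier transform vanishes almost everywhere is itself zero
almost everywhere. -/
theorem MeasureTheory.Integrable.ae_eq_zero_of_fourier_ae_eq_zero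
    {V F : Type*} [NormedAddCommGroup V] [InnerProductSpace ℝ V] [FiniteDimensional ℝ V]
    [MeasurableSpace V] [BorelSpace V] [NormedAddCommGroup F] [NormedSpace ℂ F] [CompleteSpace F]
    {f : V → F} (hf : Integrable f) (h : 𝓕 f =ᵐ[volume] 0) : f =ᵐ[volume] 0 := by
  refine ae_eq_zero_of_integral_contDiff_smul_eq_zero hf.locallyIntegrable fun g hg hgc ↦ ?_
  have hg' : ContDiff ℝ ∞ fun x ↦ (g x : ℂ) := Complex.ofRealCLM.contDiff.comp hg
  have hgc' : HasCompactSupport fun x ↦ (g x : ℂ) := hgc.comp_left Complex.ofReal_zero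
  obtain ⟨ψ, hψ⟩ : ∃ ψ : SchwartzMap V ℂ, 𝓕 (ψ : V → ℂ) = fun x ↦ (g x : ℂ) := by
    refine ⟨𝓕⁻ (hgc'.toSchwartzMap hg'), ?_⟩
    rw [← SchwartzMap.fourier_coe, FourierTransform.fourier_fourierInv_eq]
    rfl
  have hself : ∫ x, 𝓕 (ψ : V → ℂ) x • f x = ∫ ξ, ψ ξ • 𝓕 f ξ := by
    simpa using! VectorFourier.integral_fourierIntegral_smul_eq_flip (L := innerₗ V)
      Real.continuous_fourierChar continuous_inner ψ.integrable hf
  have hzero : ∫ ξ, ψ ξ • 𝓕 f ξ = 0 :=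
    integral_eq_zero_of_ae (h.mono fun ξ hξ ↦ by simp [hξ])
  rw [hψ, hzero] at hself
  simpa using hself

/-- The Fourier transform of a nonnegative function with all exponential moments is
real-analytic. -/
theorem analyticOnNhd_fourier_of_integrable_exp_mul {f : ℝ → ℝ} (hf : Measurable f)
    (hf₀ : ∀ x, 0 ≤ f x) (hexp : ∀ t : ℝ, Integrable fun x ↦ Real.exp (t * x) * f x) :
    AnalyticOnNhd ℝ (𝓕 fun x ↦ (f x : ℂ)) Set.univ := by
  set μ : Measure ℝ := volume.withDensity fun x ↦ ENNReal.ofReal (f x)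
  have hset : ProbabilityTheory.integrableExpSet id μ = Set.univ := by
    refine Set.eq_univ_of_forall fun t ↦ ?_
    change Integrable (fun x ↦ Real.exp (t * x)) μ
    rw [integrable_withDensity_iff (by fun_prop) (by simp)]
    simpa [ENNReal.toReal_ofReal, hf₀] using hexp t
  have hfourier : (𝓕 fun x ↦ (f x : ℂ)) =
      fun ξ : ℝ ↦ ProbabilityTheory.complexMGF id μ (-2 * Real.pi * Complex.I * (ξ : ℂ)) := by
    ext ξ
    rw [Real.fourier_real_eq_integral_exp_smul, ProbabilityTheory.complexMGF,
      integral_withDensity_eq_integral_toReal_smul (by fun_prop) (by simp)]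
    refine integral_congr_ae (.of_forall fun x ↦ ?_)
    simp only [ENNReal.toReal_ofReal (hf₀ x), Complex.real_smul, smul_eq_mul, id]
    rw [mul_comm]
    congr 2
    push_cast
    ring
  rw [hfourier]
  intro ξ _
  have hmgf : AnalyticAt ℂ (ProbabilityTheory.complexMGF id μ)
      (-2 * Real.pi * Complex.I * (ξ : ℂ)) :=
    ProbabilityTheory.analyticAt_complexMGF (by simp [hset])
  exact hmgf.restrictScalars.comp_of_eq
    (analyticAt_const.mul (Complex.ofRealCLM.analyticAt ξ)) rfl

end Fourier

section Gaussian

theorem integrable_polynomial_mul_exp_neg_mul_sq (Q : ℝ[X]) {b : ℝ} (hb : 0 < b) :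
    Integrable fun x : ℝ ↦ Q.eval x * Real.exp (-b * x ^ 2) := by
  induction Q using Polynomial.induction_on' with
  | add p q hp hq => simpa only [eval_add, add_mul] using! hp.add hq
  | monomial n a =>
    have hn : (-1 : ℝ) < n := by linarith [(Nat.cast_nonneg n : (0 : ℝ) ≤ n)]
    simpa [mul_assoc] using (integrable_rpow_mul_exp_neg_mul_sq hb hn).const_mul a

theorem integrable_exp_mul_polynomial_mul_exp_neg_sq (Q : ℝ[X]) (t : ℝ) :
    Integrable fun x : ℝ ↦ Real.exp (t * x) * (Q.eval x * Real.exp (-x ^ 2)) := by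
  have h := (integrable_polynomial_mul_exp_neg_mul_sq Q (one_half_pos (α := ℝ))).bdd_mul
    (f := fun x ↦ Real.exp (t * x - x ^ 2 / 2)) (c := Real.exp (t ^ 2 / 2))
    (by fun_prop) (.of_forall fun x ↦ by
      rw [Real.norm_of_nonneg (Real.exp_nonneg _)]
      exact Real.exp_le_exp.2 (by nlinarith [sq_nonneg (x - t)]))
  refine h.congr (.of_forall fun x ↦ ?_)
  have : Real.exp (t * x - x ^ 2 / 2) * Real.exp (-(1 / 2) * x ^ 2) =
      Real.exp (t * x) * Real.exp (-x ^ 2) := by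
    rw [← Real.exp_add, ← Real.exp_add]
    ring_nf
  linear_combination Q.eval x * this

end Gaussian

open scoped FourierTransform Convolution in
/-- Convolution against a nonzero nonnegative kernel, continuous and with all exponential moments,
is injective on integrable functions. -/
theorem ae_eq_zero_of_integral_comp_sub_mul_eq_zero {v g : ℝ → ℝ} (hv : Integrable v)
    (hg : Continuous g) (hg₀ : ∀ x, 0 ≤ g x) (hg_ne : g ≠ 0)
    (hexp : ∀ t : ℝ, Integrable fun x ↦ Real.exp (t * x) * g x)
    (h : ∀ p : ℝ, ∫ x, v (x - p) * g x = 0) : v =ᵐ[volume] 0 := by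
  have hg_int : Integrable g := by simpa using hexp 0
  set G : ℝ → ℂ := fun x ↦ (g x : ℂ)
  set w : ℝ → ℂ := fun x ↦ (v (-x) : ℂ)
  have hw : Integrable w := hv.comp_neg.ofReal
  have hconv : G ⋆[ContinuousLinearMap.mul ℂ ℂ] w = 0 := by
    ext p
    have hp : ∫ x, G x * w (p - x) = ((∫ x, v (x - p) * g x : ℝ) : ℂ) := by
      rw [← integral_complex_ofReal]
      simp [G, w, mul_comm]
    simpa [convolution, h p] using hp
  have hprod (ξ : ℝ) : 𝓕 G ξ * 𝓕 w ξ = 0 := by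
    have hG : Integrable G := hg_int.ofReal
    rw [← Real.fourier_mul_convolution_eq hG hw, hconv]
    simp [Real.fourier_eq]
  have hG₀ : 𝓕 G 0 ≠ 0 := by
    have hint : 𝓕 G 0 = ((∫ x, g x : ℝ) : ℂ) := by
      rw [← integral_complex_ofReal]
      simp [Real.fourier_eq, G]
    rw [hint, Complex.ofReal_ne_zero, Ne, integral_eq_zero_iff_of_nonneg hg₀ hg_int,
      hg.ae_eq_iff_eq volume continuous_zero]
    exact hg_ne
  have hG_ae : ∀ᵐ ξ : ℝ, 𝓕 G ξ ≠ 0 := by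
    have hcodiscrete := (analyticOnNhd_fourier_of_integrable_exp_mul hg.measurable hg₀ hexp)
      |>.preimage_zero_mem_codiscrete hG₀
    rw [← Measure.restrict_univ (μ := (volume : Measure ℝ))]
    exact ae_restrict_le_codiscreteWithin MeasurableSet.univ hcodiscrete
  have hw₀ : w =ᵐ[volume] 0 := hw.ae_eq_zero_of_fourier_ae_eq_zero <| hG_ae.mono fun ξ hξ ↦
    (mul_eq_zero.1 (hprod ξ)).resolve_left hξ
  filter_upwards [(Measure.measurePreserving_neg volume).quasiMeasurePreserving.ae hw₀] with x hx
  simpa [w] using hx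

/-- If `v : ℝ → ℝ` is integrable and for every `p`
`∫ v(x − p) · H_n(x)² · e^{−x²} dx = 0`, where `H_n` is the probabilists'
Hermite polynomial, then `v = 0` almost everywhere. -/
theorem hermite_convolution_injectivity
    (n : ℕ) (v : ℝ → ℝ) (hv : Integrable v)
    (h : ∀ p : ℝ,
      ∫ x : ℝ, v (x - p) * (aeval x (hermite n) : ℝ) ^ 2 * Real.exp (-x ^ 2) = 0) :
    v =ᵐ[volume] 0 := by
  set Q : ℝ[X] := (hermite n).map (Int.castRingHom ℝ) with hQ
  have hQ_ne : Q ≠ 0 := ((hermite_monic n).map _).ne_zero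
  have hQ_eval (x : ℝ) : aeval x (hermite n) = Q.eval x := by
    rw [hQ, eval_map, aeval_def, algebraMap_int_eq]
  simp only [hQ_eval, mul_assoc] at h
  refine ae_eq_zero_of_integral_comp_sub_mul_eq_zero hv (by fun_prop) (fun x ↦ by positivity)
    (fun hzero ↦ hQ_ne (Polynomial.funext fun x ↦ ?_)) (fun t ↦ ?_) h
  · simpa using congrFun hzero x
  · simp only [← Polynomial.eval_pow]
    exact integrable_exp_mul_polynomial_mul_exp_neg_sq (Q ^ 2) t
end

section
/- Let f : ℝ → ℂ be measurable and suppose there exist constants C > 0 and a > 0 such that |f(x)| ≤ C·e^{−a|x|} for almost every x ∈ ℝ, and f is not almost everywhere equal to 0. Then the zero set {ξ ∈ ℝ : 𝓕f(ξ) = 0} of its Fourier transform has Lebesgue measure zero. -/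
open MeasureTheory Filter

open scoped FourierTransform

/-- An integrable function whose Fourier transform vanishes identically is a.e. zero. -/
theorem MeasureTheory.Integrable.ae_eq_zero_of_fourier_eq_zero
    {V E : Type*} [NormedAddCommGroup V] [InnerProductSpace ℝ V] [FiniteDimensional ℝ V]
    [MeasurableSpace V] [BorelSpace V]
    [NormedAddCommGroup E] [NormedSpace ℂ E] [CompleteSpace E]
    {f : V → E} (hf : Integrable f) (h : 𝓕 f = 0) : f =ᵐ[volume] 0 := by
  refine ae_eq_zero_of_integral_contDiff_smul_eq_zero hf.locallyIntegrable fun g hg hgc ↦ ?_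
  have hgc' : HasCompactSupport (fun x ↦ (g x : ℂ)) := hgc.comp_left Complex.ofReal_zero
  let φ : SchwartzMap V ℂ := hgc'.toSchwartzMap (Complex.ofRealCLM.contDiff.comp hg)
  let ψ : SchwartzMap V ℂ := 𝓕⁻ φ
  have hψ : 𝓕 (ψ : V → ℂ) = φ := by
    rw [← SchwartzMap.fourier_coe, FourierTransform.fourier_fourierInv_eq]
  have key : ∫ ξ, 𝓕 (ψ : V → ℂ) ξ • f ξ = ∫ x, ψ x • 𝓕 f x := by
    simpa using! VectorFourier.integral_fourierIntegral_smul_eq_flip (L := innerₗ V)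
      Real.continuous_fourierChar continuous_inner ψ.integrable hf
  rw [h, hψ, show ⇑φ = fun x ↦ (g x : ℂ) from rfl] at key
  simpa using key

/-- `x ↦ exp (-b |x|)` is integrable on the real line for `b > 0`. -/
theorem integrable_exp_neg_mul_abs {b : ℝ} (hb : 0 < b) :
    Integrable fun x : ℝ ↦ Real.exp (-b * |x|) := by
  rw [← integrableOn_univ, ← Set.Iic_union_Ioi (a := (0 : ℝ))]
  refine IntegrableOn.union ?_ ?_
  · refine (integrableOn_exp_mul_Iic hb 0).congr_fun (fun x hx ↦ ?_) measurableSet_Iic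
    simp [abs_of_nonpos (Set.mem_Iic.1 hx)]
  · refine (integrableOn_exp_mul_Ioi (neg_lt_zero.2 hb) 0).congr_fun (fun x hx ↦ ?_)
      measurableSet_Ioi
    simp [abs_of_pos (Set.mem_Ioi.1 hx)]

theorem integrable_of_norm_le_exp_neg_mul_abs {E : Type*} [NormedAddCommGroup E] {f : ℝ → E}
    (hf : AEStronglyMeasurable f) {C a : ℝ} (ha : 0 < a)
    (hdecay : ∀ᵐ x : ℝ, ‖f x‖ ≤ C * Real.exp (-a * |x|)) : Integrable f :=
  ((integrable_exp_neg_mul_abs ha).const_mul C).mono' hf hdecay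

/-- The Fourier–Laplace integral of an exponentially decaying function is holomorphic on a strip
around the real axis. -/
theorem differentiableOn_integral_cexp_smul_of_exp_decay
    {E : Type*} [NormedAddCommGroup E] [NormedSpace ℂ E]
    {f : ℝ → E} (hf : AEStronglyMeasurable f) {C a : ℝ}
    (hdecay : ∀ᵐ x : ℝ, ‖f x‖ ≤ C * Real.exp (-a * |x|)) :
    DifferentiableOn ℂ (fun z : ℂ ↦ ∫ x : ℝ, Complex.exp (-2 * Real.pi * x * z * Complex.I) • f x)
      {z : ℂ | 2 * Real.pi * |z.im| < a} := by
  intro z₀ hz₀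
  obtain ⟨c, hzc, hca⟩ := exists_between (Set.mem_ofPred.1 hz₀)
  have hopen : IsOpen {z : ℂ | 2 * Real.pi * |z.im| < c} :=
    isOpen_lt (by fun_prop) continuous_const
  have hmeas : ∀ z : ℂ, AEStronglyMeasurable
      fun x : ℝ ↦ Complex.exp (-2 * Real.pi * x * z * Complex.I) • f x := fun z ↦
    (Continuous.aestronglyMeasurable (by fun_prop)).smul hf
  have hnorm : ∀ z ∈ {z : ℂ | 2 * Real.pi * |z.im| < c}, ∀ x : ℝ,
      ‖Complex.exp (-2 * Real.pi * x * z * Complex.I)‖ ≤ Real.exp (c * |x|) := by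
    intro z hz x
    have hre : (-2 * Real.pi * x * z * Complex.I).re = 2 * Real.pi * (x * z.im) := by
      simp; ring
    rw [Complex.norm_exp, hre, Real.exp_le_exp]
    calc 2 * Real.pi * (x * z.im) ≤ 2 * Real.pi * |x * z.im| := by gcongr; exact le_abs_self _
      _ = 2 * Real.pi * |z.im| * |x| := by rw [abs_mul]; ring
      _ ≤ c * |x| := by gcongr; exact hz.le
  set δ := (a - c) / 2 with hδ
  have hδ0 : 0 < δ := by linarith
  refine (hasDerivAt_integral_of_dominated_loc_of_deriv_le (𝕜 := ℂ) (hopen.mem_nhds hzc)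
    (F' := fun z x ↦ ((-2 * Real.pi * x * Complex.I) *
      Complex.exp (-2 * Real.pi * x * z * Complex.I)) • f x)
    (bound := fun x ↦ 2 * Real.pi * δ⁻¹ * C * Real.exp (-δ * |x|))
    (Eventually.of_forall hmeas) ?_ ?_ ?_
    ((integrable_exp_neg_mul_abs hδ0).const_mul _) ?_).2.differentiableAt.differentiableWithinAt
  · refine integrable_of_norm_le_exp_neg_mul_abs (hmeas z₀) (C := C) (sub_pos.2 hca) ?_
    filter_upwards [hdecay] with x hx
    calc ‖Complex.exp (-2 * Real.pi * x * z₀ * Complex.I) • f x‖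
        ≤ Real.exp (c * |x|) * (C * Real.exp (-a * |x|)) := by
          rw [norm_smul]; gcongr; exact hnorm z₀ hzc x
      _ = C * Real.exp (-(a - c) * |x|) := by
          rw [mul_left_comm, ← Real.exp_add]; ring_nf
  · exact (Continuous.aestronglyMeasurable (by fun_prop)).smul hf
  · filter_upwards [hdecay] with x hx z hz
    have hlin : |x| ≤ δ⁻¹ * Real.exp (δ * |x|) := by
      rw [← div_eq_inv_mul, le_div_iff₀ hδ0, mul_comm]
      linarith [Real.add_one_le_exp (δ * |x|)]
    calc _ = 2 * Real.pi * |x| * ‖Complex.exp (-2 * Real.pi * x * z * Complex.I)‖ * ‖f x‖ := by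
          simp [norm_smul, abs_of_pos Real.pi_pos]
      _ ≤ 2 * Real.pi * (δ⁻¹ * Real.exp (δ * |x|)) * Real.exp (c * |x|) *
          (C * Real.exp (-a * |x|)) := by
          gcongr; exact hnorm z hz x
      _ = 2 * Real.pi * δ⁻¹ * C *
          (Real.exp (δ * |x|) * Real.exp (c * |x|) * Real.exp (-a * |x|)) := by ring
      _ = _ := by
          rw [← Real.exp_add, ← Real.exp_add, hδ]; ring_nf
  · refine Eventually.of_forall fun x z _ ↦ HasDerivAt.smul_const ?_ _
    have h1 : HasDerivAt (fun z : ℂ ↦ -2 * Real.pi * x * z * Complex.I)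
        (-2 * Real.pi * x * Complex.I) z := by
      simpa using ((hasDerivAt_id z).const_mul (-2 * Real.pi * x : ℂ)).mul_const Complex.I
    simpa [mul_comm] using h1.cexp

/-- The Fourier transform of an exponentially decaying function is real-analytic. -/
theorem analyticOnNhd_fourier_of_exp_decay
    {E : Type*} [NormedAddCommGroup E] [NormedSpace ℂ E] [CompleteSpace E]
    {f : ℝ → E} (hf : AEStronglyMeasurable f) {C a : ℝ} (ha : 0 < a)
    (hdecay : ∀ᵐ x : ℝ, ‖f x‖ ≤ C * Real.exp (-a * |x|)) :
    AnalyticOnNhd ℝ (𝓕 f) Set.univ := by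
  intro ξ _
  have hopen : IsOpen {z : ℂ | 2 * Real.pi * |z.im| < a} :=
    isOpen_lt (by fun_prop) continuous_const
  have hF := ((differentiableOn_integral_cexp_smul_of_exp_decay hf hdecay).analyticOnNhd hopen
    (ξ : ℂ) (by simpa using ha)).restrictScalars (𝕜 := ℝ)
  have hcomp := hF.comp_of_eq (Complex.ofRealCLM.analyticAt ξ) rfl
  refine hcomp.congr (Eventually.of_forall fun η ↦ ?_)
  simp [Real.fourier_real_eq_integral_exp_smul]

/-- If `f : ℝ → ℂ` is measurable, satisfies
`|f(x)| ≤ C e^{−a|x|}` a.e. for some `C, a > 0`, and is not a.e. zero, then the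
zero set of its Fourier transform `𝓕f(ξ) = ∫ f(x) e^{−2πixξ} dx` has Lebesgue
measure zero. -/
theorem fourier_zero_set_of_exp_decay
    (f : ℝ → ℂ) (hmeas : Measurable f)
    (C a : ℝ) (hC : 0 < C) (ha : 0 < a)
    (hdecay : ∀ᵐ x : ℝ, ‖f x‖ ≤ C * Real.exp (-a * |x|))
    (hne : ¬ (f =ᵐ[volume] 0)) :
    volume {ξ : ℝ | 𝓕 f ξ = 0} = 0 := by
  have hf := hmeas.aestronglyMeasurable (μ := volume)
  rcases (analyticOnNhd_fourier_of_exp_decay hf ha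
    hdecay).eqOn_zero_or_eventually_ne_zero_of_preconnected isPreconnected_univ with h | h
  · exact absurd ((integrable_of_norm_le_exp_neg_mul_abs hf ha
      hdecay).ae_eq_zero_of_fourier_eq_zero (Set.eqOn_univ _ _ |>.1 h)) hne
  · have h' := ae_restrict_le_codiscreteWithin (μ := volume) MeasurableSet.univ h
    rw [Measure.restrict_univ] at h'
    simpa [mem_ae_iff, Set.compl_ofPred] using h'
end
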